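/- arXiv:2301.05674 — 5 statements merged into one kernel-verified Lean document; each statement's English description precedes it below -/
import Mathlib

section
/- Let G be a network of friends on N = {1,…,n}, let Γ and Δ be coalition structures on N, and let i ∈ N. If M ≥ n² and Σ_{f ∈ F_i} v_f(Γ) > Σ_{f ∈ F_i} v_f(Δ), then u^sumAL_i(Γ) > u^sumAL_i(Δ), i.e., player i strictly prefers Γ to Δ under sum-based altruistic-treatment preferences. -/
namespace ACFG

/-- A coalition structure on the player set `Fin n` (the players `1,…,n`), represented by
the map sending each player to her coalition (her block of the partition). -/
structure CoalitionStructure (n : ℕ) where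
  block : Fin n → Finset (Fin n)
  mem_block : ∀ i, i ∈ block i
  block_eq : ∀ i j, j ∈ block i → block j = block i

variable {n : ℕ}

/-- The set `F_i` of friends of player `i` in the network of friends `G`. -/
def friends (G : SimpleGraph (Fin n)) [DecidableRel G.Adj] (i : Fin n) : Finset (Fin n) :=
  Finset.univ.filter (fun j => G.Adj i j)

/-- The set `E_i` of enemies of player `i`: all players other than `i` and her friends. -/
def enemies (G : SimpleGraph (Fin n)) [DecidableRel G.Adj] (i : Fin n) : Finset (Fin n) :=
  (insert i (friends G i))ᶜ

/-- The friend-oriented value of player `i` for the coalition structure `Γ`: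
`v_i(Γ) = n·|Γ(i) ∩ F_i| − |Γ(i) ∩ E_i|`. -/
def val (G : SimpleGraph (Fin n)) [DecidableRel G.Adj] (Γ : CoalitionStructure n)
    (i : Fin n) : ℤ :=
  (n : ℤ) * ((Γ.block i ∩ friends G i).card : ℤ) - ((Γ.block i ∩ enemies G i).card : ℤ)

/-- `sumF_i(Γ)`: the sum of the values of `i`'s friends. -/
def sumF (G : SimpleGraph (Fin n)) [DecidableRel G.Adj] (Γ : CoalitionStructure n)
    (i : Fin n) : ℤ :=
  ∑ f ∈ friends G i, val G Γ f

/-- `sumF+_i(Γ)`: the sum of the values of `i`'s friends and of `i` herself. -/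
def sumFplus (G : SimpleGraph (Fin n)) [DecidableRel G.Adj] (Γ : CoalitionStructure n)
    (i : Fin n) : ℤ :=
  ∑ f ∈ insert i (friends G i), val G Γ f

/-- `minF_i(Γ)`: the minimum of the values of `i`'s friends (`0` if `i` has no friends). -/
def minF (G : SimpleGraph (Fin n)) [DecidableRel G.Adj] (Γ : CoalitionStructure n)
    (i : Fin n) : ℤ :=
  if h : (friends G i).Nonempty then (friends G i).inf' h (val G Γ) else 0

/-- `minF+_i(Γ)`: the minimum of the values of `i`'s friends and of `i` herself. -/
def minFplus (G : SimpleGraph (Fin n)) [DecidableRel G.Adj] (Γ : CoalitionStructure n)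
    (i : Fin n) : ℤ :=
  (insert i (friends G i)).inf' (Finset.insert_nonempty _ _) (val G Γ)

/-- Sum-based selfish-first utility: `u^sumSF_i(Γ) = M·v_i(Γ) + sumF_i(Γ)`. -/
def usumSF (G : SimpleGraph (Fin n)) [DecidableRel G.Adj] (M : ℤ) (Γ : CoalitionStructure n)
    (i : Fin n) : ℤ :=
  M * val G Γ i + sumF G Γ i

/-- Sum-based equal-treatment utility: `u^sumEQ_i(Γ) = sumF+_i(Γ)`. -/
def usumEQ (G : SimpleGraph (Fin n)) [DecidableRel G.Adj] (Γ : CoalitionStructure n)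
    (i : Fin n) : ℤ :=
  sumFplus G Γ i

/-- Sum-based altruistic-treatment utility: `u^sumAL_i(Γ) = v_i(Γ) + M·sumF_i(Γ)`. -/
def usumAL (G : SimpleGraph (Fin n)) [DecidableRel G.Adj] (M : ℤ) (Γ : CoalitionStructure n)
    (i : Fin n) : ℤ :=
  val G Γ i + M * sumF G Γ i

/-- Min-based selfish-first utility: `u^minSF_i(Γ) = M·v_i(Γ) + minF_i(Γ)`. -/
def uminSF (G : SimpleGraph (Fin n)) [DecidableRel G.Adj] (M : ℤ) (Γ : CoalitionStructure n)
    (i : Fin n) : ℤ :=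
  M * val G Γ i + minF G Γ i

/-- Min-based equal-treatment utility: `u^minEQ_i(Γ) = minF+_i(Γ)`. -/
def uminEQ (G : SimpleGraph (Fin n)) [DecidableRel G.Adj] (Γ : CoalitionStructure n)
    (i : Fin n) : ℤ :=
  minFplus G Γ i

/-- Min-based altruistic-treatment utility: `u^minAL_i(Γ) = v_i(Γ) + M·minF_i(Γ)`. -/
def uminAL (G : SimpleGraph (Fin n)) [DecidableRel G.Adj] (M : ℤ) (Γ : CoalitionStructure n)
    (i : Fin n) : ℤ :=
  val G Γ i + M * minF G Γ i

/-- A player, her friends and her enemies make up the whole player set. -/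
theorem card_friends_add_card_enemies (G : SimpleGraph (Fin n)) [DecidableRel G.Adj]
    (i : Fin n) : (friends G i).card + (enemies G i).card + 1 = n := by
  have hi : i ∉ friends G i := by simp [friends]
  have h := Finset.card_add_card_compl (insert i (friends G i))
  rw [Finset.card_insert_of_notMem hi, Fintype.card_fin] at h
  unfold enemies
  omega

theorem val_le (G : SimpleGraph (Fin n)) [DecidableRel G.Adj] (Γ : CoalitionStructure n)
    (i : Fin n) : val G Γ i ≤ n * (friends G i).card := by
  have h : n * (Γ.block i ∩ friends G i).card ≤ n * (friends G i).card := by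
    gcongr
    exact Finset.inter_subset_right
  unfold val
  zify at h
  linarith [Int.natCast_nonneg (Γ.block i ∩ enemies G i).card]

theorem neg_card_enemies_le_val (G : SimpleGraph (Fin n)) [DecidableRel G.Adj]
    (Γ : CoalitionStructure n) (i : Fin n) : -((enemies G i).card : ℤ) ≤ val G Γ i := by
  have h : (Γ.block i ∩ enemies G i).card ≤ (enemies G i).card :=
    Finset.card_le_card Finset.inter_subset_right
  unfold val
  zify at h
  have : (0 : ℤ) ≤ n * (Γ.block i ∩ friends G i).card := by positivity
  linarith

/-- Two values of the same player differ by less than `n²`. -/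
theorem val_sub_val_lt_sq (G : SimpleGraph (Fin n)) [DecidableRel G.Adj]
    (Γ Δ : CoalitionStructure n) (i : Fin n) : val G Δ i - val G Γ i < (n : ℤ) ^ 2 := by
  have hcard := card_friends_add_card_enemies G i
  have hΔ := val_le G Δ i
  have hΓ := neg_card_enemies_le_val G Γ i
  zify at hcard
  have hn : (1 : ℤ) ≤ n := by
    have := i.pos
    omega
  have he : (0 : ℤ) ≤ (enemies G i).card := Int.natCast_nonneg _
  have hsq : (n : ℤ) ^ 2 = n * (friends G i).card + n * (enemies G i).card + n := by
    linear_combination -(n : ℤ) * hcard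
  nlinarith [mul_le_mul_of_nonneg_right hn he]

/-- If `M ≥ n²` and `sumF_i(Γ) > sumF_i(Δ)`, then player `i` strictly
prefers `Γ` to `Δ` under sum-based altruistic-treatment preferences. -/
theorem sumAL_altruistic_first (G : SimpleGraph (Fin n)) [DecidableRel G.Adj] (M : ℤ)
    (hM : (n : ℤ) ^ 2 ≤ M) (Γ Δ : CoalitionStructure n) (i : Fin n)
    (h : sumF G Δ i < sumF G Γ i) :
    usumAL G M Δ i < usumAL G M Γ i := by
  have hval := val_sub_val_lt_sq G Γ Δ i
  have hM0 : 0 ≤ M := (sq_nonneg (n : ℤ)).trans hM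
  have hmul : M * (sumF G Δ i + 1) ≤ M * sumF G Γ i := mul_le_mul_of_nonneg_left h hM0
  unfold usumAL
  linarith

end ACFG
end

section
/- All sum-based altruistic coalition-formation preferences are unanimous: let G be a network of friends on N = {1,…,n} with M ≥ n³, let i ∈ N, and let Γ, Δ be coalition structures on N. If v_a(Γ) > v_a(Δ) for every a ∈ F_i ∪ {i}, then u_i(Γ) > u_i(Δ) for each of the three sum-based utilities u^sumSF_i, u^sumEQ_i, and u^sumAL_i. -/
namespace ACFG

variable {n : ℕ}

/-- All sum-based altruistic coalition-formation preferences are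
unanimous: if every member of `F_i ∪ {i}` strictly prefers the coalition structure `Γ`
to `Δ` (with respect to the friend-oriented values), then `i` strictly prefers `Γ` to `Δ`
under each of the sum-based SF, EQ, and AL utilities (for `M ≥ n³`). -/
theorem sum_based_unanimous (G : SimpleGraph (Fin n)) [DecidableRel G.Adj] (M : ℤ)
    (hM : (n : ℤ) ^ 3 ≤ M) (i : Fin n) (Γ Δ : CoalitionStructure n)
    (h : ∀ a ∈ insert i (friends G i), val G Δ a < val G Γ a) :
    usumSF G M Δ i < usumSF G M Γ i ∧
      usumEQ G Δ i < usumEQ G Γ i ∧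
      usumAL G M Δ i < usumAL G M Γ i := by
  have hi := h i (Finset.mem_insert_self _ _)
  have hn : (0 : ℤ) < n := by exact_mod_cast i.pos
  have hM0 : 0 < M := (pow_pos hn 3).trans_le hM
  have hsum : sumF G Δ i ≤ sumF G Γ i :=
    Finset.sum_le_sum fun a ha => (h a (Finset.mem_insert_of_mem ha)).le
  refine ⟨?_, Finset.sum_lt_sum_of_nonempty (Finset.insert_nonempty _ _) h, ?_⟩
  · exact add_lt_add_of_lt_of_le (mul_lt_mul_of_pos_left hi hM0) hsum
  · exact add_lt_add_of_lt_of_le hi (mul_le_mul_of_nonneg_left hsum hM0.le)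

end ACFG
end

section
/- All min-based altruistic coalition-formation preferences are unanimous: let G be a network of friends on N = {1,…,n} with M ≥ n³, let i ∈ N, and let Γ, Δ be coalition structures on N. If v_a(Γ) > v_a(Δ) for every a ∈ F_i ∪ {i}, then u_i(Γ) > u_i(Δ) for each of the three min-based utilities u^minSF_i, u^minEQ_i, and u^minAL_i. -/
namespace ACFG

variable {n : ℕ}

theorem minF_le_minF (G : SimpleGraph (Fin n)) [DecidableRel G.Adj] {i : Fin n}
    {Γ Δ : CoalitionStructure n} (h : ∀ a ∈ friends G i, val G Δ a ≤ val G Γ a) :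
    minF G Δ i ≤ minF G Γ i := by
  unfold minF
  split_ifs
  · exact Finset.inf'_mono_fun h
  · exact le_rfl

theorem minFplus_lt_minFplus (G : SimpleGraph (Fin n)) [DecidableRel G.Adj] {i : Fin n}
    {Γ Δ : CoalitionStructure n} (h : ∀ a ∈ insert i (friends G i), val G Δ a < val G Γ a) :
    minFplus G Δ i < minFplus G Γ i :=
  (Finset.lt_inf'_iff _).2 fun a ha => (Finset.inf'_le _ ha).trans_lt (h a ha)

/-- All min-based altruistic coalition-formation preferences are
unanimous: if every member of `F_i ∪ {i}` strictly prefers the coalition structure `Γ`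
to `Δ` (with respect to the friend-oriented values), then `i` strictly prefers `Γ` to `Δ`
under each of the min-based SF, EQ, and AL utilities (for `M ≥ n³`). -/
theorem min_based_unanimous (G : SimpleGraph (Fin n)) [DecidableRel G.Adj] (M : ℤ)
    (hM : (n : ℤ) ^ 3 ≤ M) (i : Fin n) (Γ Δ : CoalitionStructure n)
    (h : ∀ a ∈ insert i (friends G i), val G Δ a < val G Γ a) :
    uminSF G M Δ i < uminSF G M Γ i ∧
      uminEQ G Δ i < uminEQ G Γ i ∧
      uminAL G M Δ i < uminAL G M Γ i := by
  have hn : (0 : ℤ) < n := by exact_mod_cast i.pos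
  have hM0 : 0 < M := (pow_pos hn 3).trans_le hM
  have hi := h i (Finset.mem_insert_self _ _)
  have hF : minF G Δ i ≤ minF G Γ i :=
    minF_le_minF G fun a ha => (h a (Finset.mem_insert_of_mem ha)).le
  exact ⟨add_lt_add_of_lt_of_le (mul_lt_mul_of_pos_left hi hM0) hF,
    minFplus_lt_minFplus G h,
    add_lt_add_of_lt_of_le hi (mul_le_mul_of_nonneg_left hF hM0.le)⟩

end ACFG
end

section
/- Sum-based selfish-first preferences are type-I-monotonic and type-II-monotonic: let G be a network of friends on N = {1,…,n} with M ≥ n³, let i ∈ N, let j ∈ E_i, let Γ, Δ be coalition structures on N with v_j(Γ) ≥ v_j(Δ), and let G' be the graph obtained from G by adding the edge {i,j}; write u' for the sum-based selfish-first utility in G'. If j ∈ Γ(i) ∩ Δ(i) or j ∈ Γ(i) \ Δ(i), then u^sumSF_i(Γ) > u^sumSF_i(Δ) implies u'^sumSF_i(Γ) > u'^sumSF_i(Δ), and u^sumSF_i(Γ) = u^sumSF_i(Δ) implies u'^sumSF_i(Γ) ≥ u'^sumSF_i(Δ). -/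
namespace ACFG

variable {n : ℕ}

/-- The graph `G'` obtained from `G` by adding the edge `{i, j}`. -/
def addEdge (G : SimpleGraph (Fin n)) (i j : Fin n) : SimpleGraph (Fin n) :=
  G ⊔ SimpleGraph.fromEdgeSet {s(i, j)}

instance (G : SimpleGraph (Fin n)) [DecidableRel G.Adj] (i j : Fin n) :
    DecidableRel (addEdge G i j).Adj := fun a b =>
  decidable_of_iff (G.Adj a b ∨ (s(a, b) = s(i, j) ∧ a ≠ b)) (by
    simp [addEdge, SimpleGraph.fromEdgeSet_adj])

theorem val_eq_of_card (G : SimpleGraph (Fin n)) [DecidableRel G.Adj]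
    (Γ : CoalitionStructure n) (a : Fin n) :
    val G Γ a = ((n : ℤ) + 1) * ((Γ.block a ∩ friends G a).card : ℤ)
      - ((Γ.block a).card : ℤ) + 1 := by
  have hnot : a ∉ Γ.block a ∩ friends G a := by simp [friends]
  have hinter : Γ.block a ∩ insert a (friends G a) = insert a (Γ.block a ∩ friends G a) :=
    Finset.inter_insert_of_mem (Γ.mem_block a)
  have hcard := Finset.card_inter_add_card_sdiff (Γ.block a) (insert a (friends G a))
  rw [hinter, Finset.card_insert_of_notMem hnot, Finset.sdiff_eq_inter_compl] at hcard
  unfold val enemies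
  zify at hcard
  linear_combination -hcard

theorem CoalitionStructure.mem_block_comm (Γ : CoalitionStructure n) {a b : Fin n} :
    a ∈ Γ.block b ↔ b ∈ Γ.block a :=
  ⟨fun h => Γ.block_eq b a h ▸ Γ.mem_block b, fun h => Γ.block_eq a b h ▸ Γ.mem_block a⟩

theorem val_congr (G H : SimpleGraph (Fin n)) [DecidableRel G.Adj] [DecidableRel H.Adj]
    (Γ : CoalitionStructure n) {a : Fin n} (h : friends H a = friends G a) :
    val H Γ a = val G Γ a := by
  simp only [val_eq_of_card, h]

/-- Gaining a friend `b` raises the value of `a` by `n + 1` exactly when `b` is in the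
coalition of `a`. -/
theorem val_of_friends_eq_insert (G H : SimpleGraph (Fin n)) [DecidableRel G.Adj]
    [DecidableRel H.Adj] (Γ : CoalitionStructure n) {a b : Fin n} (hb : b ∉ friends G a)
    (h : friends H a = insert b (friends G a)) :
    val H Γ a = val G Γ a + if b ∈ Γ.block a then (n : ℤ) + 1 else 0 := by
  rw [val_eq_of_card, val_eq_of_card, h]
  split_ifs with hmem
  · rw [Finset.inter_insert_of_mem hmem, Finset.card_insert_of_notMem (by simp [hb])]
    push_cast
    ring
  · rw [Finset.inter_insert_of_notMem hmem]
    ring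

theorem mem_friends_addEdge (G : SimpleGraph (Fin n)) [DecidableRel G.Adj] (i j a b : Fin n) :
    b ∈ friends (addEdge G i j) a ↔
      b ∈ friends G a ∨ ((a = i ∧ b = j ∨ a = j ∧ b = i) ∧ a ≠ b) := by
  simp [friends, addEdge, SimpleGraph.fromEdgeSet_adj]

/-- The change in the sum-based selfish-first utility of `i` when her enemy `j` becomes
her friend. -/
theorem usumSF_addEdge (G : SimpleGraph (Fin n)) [DecidableRel G.Adj] (M : ℤ) (i j : Fin n)
    (hj : j ∈ enemies G i) (Γ : CoalitionStructure n) :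
    usumSF (addEdge G i j) M Γ i =
      usumSF G M Γ i + val G Γ j + (M + 1) * if j ∈ Γ.block i then (n : ℤ) + 1 else 0 := by
  obtain ⟨hji, hjF⟩ : j ≠ i ∧ j ∉ friends G i := by simpa [enemies] using hj
  have hiF : i ∉ friends G j := by simpa [friends, G.adj_comm] using hjF
  have hFi : friends (addEdge G i j) i = insert j (friends G i) := by
    ext b
    rw [mem_friends_addEdge, Finset.mem_insert]
    grind
  have hFj : friends (addEdge G i j) j = insert i (friends G j) := by
    ext b
    rw [mem_friends_addEdge, Finset.mem_insert]
    grind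
  have hF : ∀ f ∈ friends G i, val (addEdge G i j) Γ f = val G Γ f := by
    intro f hf
    have hfi : f ≠ i := by
      rintro rfl
      simp [friends] at hf
    have hfj : f ≠ j := fun h => hjF (h ▸ hf)
    refine val_congr _ _ Γ ?_
    ext b
    simp [mem_friends_addEdge, hfi, hfj]
  rw [usumSF, usumSF, sumF, sumF, hFi, Finset.sum_insert hjF, Finset.sum_congr rfl hF,
    val_of_friends_eq_insert G _ Γ hjF hFi, val_of_friends_eq_insert G _ Γ hiF hFj]
  simp only [Γ.mem_block_comm (a := i) (b := j)]
  ring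

/-- Sum-based selfish-first preferences are type-I- and
type-II-monotonic: if the enemy `j` of `i` satisfies `j ∈ Γ(i) ∩ Δ(i)` (type I) or
`j ∈ Γ(i) \ Δ(i)` (type II) and `v_j(Γ) ≥ v_j(Δ)`, then turning `j` into a friend of `i`
preserves `i`'s strict preference of `Γ` over `Δ`, and turns indifference into weak
preference (for `M ≥ n³`). -/
theorem sumSF_monotonic (G : SimpleGraph (Fin n)) [DecidableRel G.Adj] (M : ℤ)
    (hM : (n : ℤ) ^ 3 ≤ M) (i j : Fin n) (hj : j ∈ enemies G i)
    (Γ Δ : CoalitionStructure n) (hv : val G Δ j ≤ val G Γ j)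
    (hcase : (j ∈ Γ.block i ∧ j ∈ Δ.block i) ∨ (j ∈ Γ.block i ∧ j ∉ Δ.block i)) :
    (usumSF G M Δ i < usumSF G M Γ i →
        usumSF (addEdge G i j) M Δ i < usumSF (addEdge G i j) M Γ i) ∧
      (usumSF G M Γ i = usumSF G M Δ i →
        usumSF (addEdge G i j) M Δ i ≤ usumSF (addEdge G i j) M Γ i) := by
  have hM0 : 0 ≤ M := le_trans (by positivity) hM
  have hpos : 0 ≤ (M + 1) * ((n : ℤ) + 1) := by positivity
  rw [usumSF_addEdge G M i j hj Γ, usumSF_addEdge G M i j hj Δ]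
  rcases hcase with ⟨hΓ, hΔ⟩ | ⟨hΓ, hΔ⟩
  · simp only [hΓ, hΔ, if_true]
    constructor <;> intro h <;> linarith
  · simp only [hΓ, hΔ, if_true, if_false, mul_zero]
    constructor <;> intro h <;> linarith

end ACFG
end

section
/- Min-based selfish-first preferences are type-II-monotonic: let G be a network of friends on N = {1,…,n} with M ≥ n³, let i ∈ N, let j ∈ E_i, let Γ, Δ be coalition structures on N with j ∈ Γ(i) \ Δ(i) and v_j(Γ) ≥ v_j(Δ), and let G' be the graph obtained from G by adding the edge {i,j}; write u' for the min-based selfish-first utility in G'. Then u^minSF_i(Γ) ≥ u^minSF_i(Δ) implies u'^minSF_i(Γ) > u'^minSF_i(Δ). -/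
namespace ACFG

variable {n : ℕ}

theorem neg_le_val (G : SimpleGraph (Fin n)) [DecidableRel G.Adj] (Γ : CoalitionStructure n)
    (i : Fin n) : -(n : ℤ) ≤ val G Γ i := by
  have h : ((Γ.block i ∩ enemies G i).card : ℤ) ≤ n := by
    exact_mod_cast card_finset_fin_le _
  have h' : (0 : ℤ) ≤ n * ((Γ.block i ∩ friends G i).card : ℤ) := by positivity
  unfold val
  linarith

theorem val_le_sq (G : SimpleGraph (Fin n)) [DecidableRel G.Adj] (Γ : CoalitionStructure n)
    (i : Fin n) : val G Γ i ≤ (n : ℤ) ^ 2 := by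
  have h : ((Γ.block i ∩ friends G i).card : ℤ) ≤ n := by
    exact_mod_cast card_finset_fin_le _
  have h' : (0 : ℤ) ≤ ((Γ.block i ∩ enemies G i).card : ℤ) := by positivity
  unfold val
  nlinarith [mul_le_mul_of_nonneg_left h (Int.natCast_nonneg n)]

theorem neg_le_minF (G : SimpleGraph (Fin n)) [DecidableRel G.Adj] (Γ : CoalitionStructure n)
    (i : Fin n) : -(n : ℤ) ≤ minF G Γ i := by
  unfold minF
  split_ifs with h
  · exact Finset.le_inf' h _ fun f _ => neg_le_val G Γ f
  · simp

theorem minF_le_sq (G : SimpleGraph (Fin n)) [DecidableRel G.Adj] (Γ : CoalitionStructure n)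
    (i : Fin n) : minF G Γ i ≤ (n : ℤ) ^ 2 := by
  unfold minF
  split_ifs with h
  · exact (Finset.inf'_le _ h.choose_spec).trans (val_le_sq G Γ _)
  · positivity

theorem friends_addEdge (G : SimpleGraph (Fin n)) [DecidableRel G.Adj] {i j : Fin n}
    (hij : i ≠ j) : friends (addEdge G i j) i = insert j (friends G i) := by
  ext k
  simp only [friends, addEdge, SimpleGraph.sup_adj, SimpleGraph.fromEdgeSet_adj, Finset.mem_filter,
    Finset.mem_univ, Finset.mem_insert, Set.mem_singleton_iff, Sym2.eq_iff]
  grind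

theorem enemies_addEdge (G : SimpleGraph (Fin n)) [DecidableRel G.Adj] {i j : Fin n}
    (hij : i ≠ j) : enemies (addEdge G i j) i = (enemies G i).erase j := by
  ext k
  simp only [enemies, friends_addEdge G hij, Finset.mem_compl, Finset.mem_insert, Finset.mem_erase]
  tauto

theorem ne_of_mem_enemies {G : SimpleGraph (Fin n)} [DecidableRel G.Adj] {i j : Fin n}
    (hj : j ∈ enemies G i) : i ≠ j := by
  rintro rfl
  simp [enemies] at hj

theorem val_addEdge_of_mem {G : SimpleGraph (Fin n)} [DecidableRel G.Adj] {i j : Fin n}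
    (hj : j ∈ enemies G i) {Γ : CoalitionStructure n} (h : j ∈ Γ.block i) :
    val (addEdge G i j) Γ i = val G Γ i + (n + 1) := by
  have hij := ne_of_mem_enemies hj
  have hjF : j ∉ Γ.block i ∩ friends G i := by
    simp only [enemies, Finset.mem_compl, Finset.mem_insert] at hj
    simp only [Finset.mem_inter]
    tauto
  have hjE : j ∈ Γ.block i ∩ enemies G i := Finset.mem_inter.2 ⟨h, hj⟩
  have hE := Finset.card_erase_add_one hjE
  rw [val, val, friends_addEdge G hij, enemies_addEdge G hij, Finset.inter_insert_of_mem h,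
    Finset.card_insert_of_notMem hjF, Finset.inter_erase, ← hE]
  push_cast
  ring

theorem val_addEdge_of_notMem {G : SimpleGraph (Fin n)} [DecidableRel G.Adj] {i j : Fin n}
    (hij : i ≠ j) {Γ : CoalitionStructure n} (h : j ∉ Γ.block i) :
    val (addEdge G i j) Γ i = val G Γ i := by
  have hjE : j ∉ Γ.block i ∩ enemies G i := fun hm => h (Finset.mem_inter.1 hm).1
  rw [val, val, friends_addEdge G hij, enemies_addEdge G hij, Finset.inter_insert_of_notMem h,
    Finset.inter_erase, Finset.erase_eq_of_notMem hjE]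

/-- Min-based selfish-first preferences are type-II-monotonic: if the
enemy `j` of `i` satisfies `j ∈ Γ(i) \ Δ(i)` and `v_j(Γ) ≥ v_j(Δ)`, then turning `j` into
a friend of `i` turns `i`'s weak preference of `Γ` over `Δ` into a strict one
(for `M ≥ n³`). -/
theorem minSF_typeII_monotonic (G : SimpleGraph (Fin n)) [DecidableRel G.Adj] (M : ℤ)
    (hM : (n : ℤ) ^ 3 ≤ M) (i j : Fin n) (hj : j ∈ enemies G i)
    (Γ Δ : CoalitionStructure n) (hv : val G Δ j ≤ val G Γ j)
    (hcase : j ∈ Γ.block i ∧ j ∉ Δ.block i) :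
    uminSF G M Δ i ≤ uminSF G M Γ i →
      uminSF (addEdge G i j) M Δ i < uminSF (addEdge G i j) M Γ i := by
  intro hu
  have hij := ne_of_mem_enemies hj
  have hn : (2 : ℤ) ≤ n := by
    have := i.isLt
    have := j.isLt
    have := Fin.val_ne_of_ne hij
    omega
  have hM' : 2 * (n : ℤ) < M := by nlinarith [sq_nonneg ((n : ℤ) - 2)]
  have hpos : 0 < (M - 2 * n) * ((n : ℤ) + 1) := mul_pos (by linarith) (by linarith)
  unfold uminSF at hu ⊢
  rw [val_addEdge_of_mem hj hcase.1, val_addEdge_of_notMem hij hcase.2]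
  linarith [neg_le_minF G Δ i, minF_le_sq G Γ i, neg_le_minF (addEdge G i j) Γ i,
    minF_le_sq (addEdge G i j) Δ i]

end ACFG
end
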